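/- For every p ≥ 0, every 1 ≤ m ≤ N−1, and all configurations x, y, the entries of the m-th beta term satisfy |⟨y|U_m|x⟩| ≤ (m−1)! · C(N−2, m−1) · p^m; in particular the entries of U_m are of order p^m as p → 0. -/

import Mathlib

open Finset

/-- The unit displacement on `ℤ/Lℤ` in direction `d` (`true` = `+`, `false` = `−`). -/
def step (L : ℕ) (d : Bool) : ZMod L := if d then 1 else -1

/-- The hopping map `f_i^d` on configurations: agent `i` hops one site in direction `d`. -/
def hop {N L : ℕ} (x : Fin N → ZMod L) (i : Fin N) (d : Bool) : Fin N → ZMod L :=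
  Function.update x i (x i + step L d)

/-- The equilibrium hopping rate `c_β(x,i,d) = 1/(2N(1+exp(β(E(f_i^d x) − E(x)))))`. -/
noncomputable def cb {N L : ℕ} (E : (Fin N → ZMod L) → ℝ) (β : ℝ)
    (x : Fin N → ZMod L) (i : Fin N) (d : Bool) : ℝ :=
  1 / (2 * (N : ℝ) * (1 + Real.exp (β * (E (hop x i d) - E x))))

/-- Entry `⟨y|T₀|x⟩` of the equilibrium transition matrix. -/
noncomputable def T0 {N L : ℕ} (E : (Fin N → ZMod L) → ℝ) (β : ℝ)
    (y x : Fin N → ZMod L) : ℝ :=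
  (∑ i : Fin N, ∑ d : Bool, cb E β x i d * (if y = hop x i d then 1 else 0))
    + (1 - ∑ i : Fin N, ∑ d : Bool, cb E β x i d) * (if y = x then 1 else 0)

/-- The set `S(x,i,d)` of agents of rank lower than `i` sitting at site `x_i ± 1`. -/
def Sset {N L : ℕ} (x : Fin N → ZMod L) (i : Fin N) (d : Bool) : Finset (Fin N) :=
  Finset.univ.filter (fun j => i < j ∧ x j = x i + step L d)

/-- `n(x,i,d) = #S(x,i,d)`. -/
def nS {N L : ℕ} (x : Fin N → ZMod L) (i : Fin N) (d : Bool) : ℕ := (Sset x i d).card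

/-- Entry `⟨y|T|x⟩` of the full transition matrix with supplanting rate `p`. -/
noncomputable def Tfull {N L : ℕ} (E : (Fin N → ZMod L) → ℝ) (β p : ℝ)
    (y x : Fin N → ZMod L) : ℝ :=
  (∑ i : Fin N, ∑ d : Bool,
      (cb E β x i d / (1 + p * (nS x i d : ℝ)) * (if y = hop x i d then 1 else 0)
        + ∑ j ∈ Sset x i d, ∑ d' : Bool,
            p * cb E β x i d / (2 * (1 + p * (nS x i d : ℝ))) *
              (if y = hop (hop x i d) j d' then 1 else 0)))
    + (1 - ∑ i : Fin N, ∑ d : Bool, cb E β x i d) * (if y = x then 1 else 0)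

/-- Entry `⟨y|T_n|x⟩` of the `n`-th term of the supplanting decomposition. -/
noncomputable def Tterm {N L : ℕ} (E : (Fin N → ZMod L) → ℝ) (β p : ℝ) (n : ℕ)
    (y x : Fin N → ZMod L) : ℝ :=
  ∑ i : Fin N, ∑ d : Bool,
    if nS x i d = n then
      p * cb E β x i d / (2 * (1 + (n : ℝ) * p)) *
        ∑ j ∈ Sset x i d, ∑ d' : Bool,
          ((if y = hop (hop x i d) j d' then (1 : ℝ) else 0)
            - (if y = hop x i d then 1 else 0))
    else 0

/-- The action of a permutation `σ` on configurations: `(σ·x)_i = x_{σ⁻¹(i)}`. -/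
def permAct {N L : ℕ} (σ : Equiv.Perm (Fin N)) (x : Fin N → ZMod L) : Fin N → ZMod L :=
  fun i => x (σ⁻¹ i)

/-- Entry `⟨y|U_m|x⟩` of the `m`-th beta term:
`U_m = ((−1)^{m−1}(m−1)! p^{m−1}/∏_{k=1}^m (1+kp)) ∑_{n=m}^{N−1} C(n−1,m−1)(1+np) T_n`. -/
noncomputable def Uterm {N L : ℕ} (E : (Fin N → ZMod L) → ℝ) (β p : ℝ) (m : ℕ)
    (y x : Fin N → ZMod L) : ℝ :=
  ((-1 : ℝ) ^ (m - 1) * (Nat.factorial (m - 1) : ℝ) * p ^ (m - 1) /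
      ∏ k ∈ Finset.Icc 1 m, (1 + (k : ℝ) * p)) *
    ∑ n ∈ Finset.Icc m (N - 1),
      (Nat.choose (n - 1) (m - 1) : ℝ) * (1 + (n : ℝ) * p) * Tterm E β p n y x

lemma aux_step_ne (L : ℕ) (hL : 3 ≤ L) (d : Bool) : step L d ≠ 0 := by
  haveI : Fact (1 < L) := ⟨by omega⟩
  unfold step
  split_ifs
  · exact one_ne_zero
  · exact neg_ne_zero.mpr one_ne_zero

lemma aux_hop1 {N L : ℕ} (hL : 3 ≤ L) (x y : Fin N → ZMod L) (i : Fin N) (d : Bool)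
    (h : y = hop x i d) (k : Fin N) : y k ≠ x k ↔ k = i := by
  subst h
  unfold hop
  by_cases hk : k = i
  · subst hk; simp [aux_step_ne L hL d]
  · simp [hk]

lemma aux_hop2 {N L : ℕ} (hL : 3 ≤ L) (x y : Fin N → ZMod L) (i j : Fin N) (d d' : Bool)
    (hij : i < j)
    (h : y = hop (hop x i d) j d') (k : Fin N) : y k ≠ x k ↔ (k = i ∨ k = j) := by
  subst h
  unfold hop
  by_cases hk : k = j
  · subst hk; simp [aux_step_ne L hL d', hij.ne']
  · by_cases hk2 : k = i
    · subst hk2; simp [aux_step_ne L hL d, hk]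
    · simp [hk, hk2]

open Classical in
/-- majorant of the inner sum -/
noncomputable def auxG {N L : ℕ} (x y : Fin N → ZMod L) (i : Fin N) : ℝ :=
  2 * (∑ j : Fin N, if (i < j ∧ ∀ k, y k ≠ x k ↔ (k = i ∨ k = j)) then (1:ℝ) else 0)
    + 2 * ((N:ℝ) - 1) * (if (∀ k, y k ≠ x k ↔ k = i) then (1:ℝ) else 0)

lemma aux_nS_le {N L : ℕ} (x : Fin N → ZMod L) (i : Fin N) (d : Bool) : nS x i d ≤ N - 1 := by
  have h : Sset x i d ⊆ Finset.univ.erase i := by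
    intro j hj
    simp only [Sset, Finset.mem_filter] at hj
    simp [hj.2.1.ne']
  have := Finset.card_le_card h
  simpa [nS] using this

lemma aux_inner {N L : ℕ} (hN : 2 ≤ N) (hL : 3 ≤ L) (x y : Fin N → ZMod L) (i : Fin N) (d : Bool) :
    |∑ j ∈ Sset x i d, ∑ d' : Bool,
          ((if y = hop (hop x i d) j d' then (1 : ℝ) else 0)
            - (if y = hop x i d then 1 else 0))| ≤ auxG x y i := by
  classical
  have hn : ((Sset x i d).card : ℝ) ≤ (N:ℝ) - 1 := by
    have h := aux_nS_le x i d
    have h' : (Sset x i d).card + 1 ≤ N := by unfold nS at h; omega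
    have : (((Sset x i d).card + 1 : ℕ) : ℝ) ≤ N := by exact_mod_cast h'
    push_cast at this; linarith
  set b : ℝ := if (∀ k, y k ≠ x k ↔ k = i) then (1:ℝ) else 0 with hb
  have hb0 : 0 ≤ b := by rw [hb]; split_ifs <;> norm_num
  have hB : (if y = hop x i d then (1:ℝ) else 0) ≤ b := by
    rw [hb]
    by_cases h : y = hop x i d
    · rw [if_pos h, if_pos (aux_hop1 hL x y i d h)]
    · rw [if_neg h]; split_ifs <;> norm_num
  have hB0 : (0:ℝ) ≤ (if y = hop x i d then (1:ℝ) else 0) := by split_ifs <;> norm_num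
  have hA0 : ∀ j d', (0:ℝ) ≤ (if y = hop (hop x i d) j d' then (1:ℝ) else 0) := by
    intro j d'; split_ifs <;> norm_num
  have hA : ∀ j ∈ Sset x i d, ∀ d', (if y = hop (hop x i d) j d' then (1:ℝ) else 0) ≤
      if (i < j ∧ ∀ k, y k ≠ x k ↔ (k = i ∨ k = j)) then (1:ℝ) else 0 := by
    intro j hj d'
    have hij : i < j := by
      simp only [Sset, Finset.mem_filter] at hj
      exact hj.2.1
    by_cases h : y = hop (hop x i d) j d'
    · rw [if_pos h, if_pos ⟨hij, aux_hop2 hL x y i j d d' hij h⟩]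
    · rw [if_neg h]; split_ifs <;> norm_num
  calc _ ≤ ∑ j ∈ Sset x i d, (2 * (if (i < j ∧ ∀ k, y k ≠ x k ↔ (k = i ∨ k = j)) then (1:ℝ) else 0)
            + 2 * b) := by
        refine (Finset.abs_sum_le_sum_abs _ _).trans (Finset.sum_le_sum fun j hj => ?_)
        rw [Fintype.sum_bool, abs_le]
        have h1 := hA j hj true
        have h2 := hA j hj false
        have h3 := hA0 j true
        have h4 := hA0 j false
        constructor <;> linarith
    _ ≤ _ := by
        rw [Finset.sum_add_distrib, Finset.sum_const, nsmul_eq_mul, ← Finset.mul_sum, auxG]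
        refine add_le_add ?_ ?_
        · refine mul_le_mul_of_nonneg_left ?_ (by norm_num)
          refine Finset.sum_le_sum_of_subset_of_nonneg (Finset.subset_univ _) ?_
          intro j _ _; split_ifs <;> norm_num
        · rw [← hb]
          nlinarith [mul_le_mul_of_nonneg_right hn hb0]

lemma aux_G_sum {N L : ℕ} (hN : 2 ≤ N) (x y : Fin N → ZMod L) :
    ∑ i : Fin N, auxG x y i ≤ 2 * (N:ℝ) := by
  classical
  have hN' : (2:ℝ) ≤ N := by exact_mod_cast hN
  unfold auxG
  rw [Finset.sum_add_distrib, ← Finset.mul_sum, ← Finset.mul_sum]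
  have h1 : ∑ i : Fin N, (if (∀ k, y k ≠ x k ↔ k = i) then (1:ℝ) else 0) ≤ 1 := by
    rw [Finset.sum_boole]
    norm_cast
    rw [Finset.card_le_one]
    intro a ha b hb
    simp only [Finset.mem_filter, Finset.mem_univ, true_and] at ha hb
    exact (hb a).1 ((ha a).2 rfl)
  have h2 : ∑ i : Fin N, ∑ j : Fin N,
      (if (i < j ∧ ∀ k, y k ≠ x k ↔ (k = i ∨ k = j)) then (1:ℝ) else 0) ≤ 1 := by
    rw [← Fintype.sum_prod_type' (f := fun i j : Fin N =>
      (if (i < j ∧ ∀ k, y k ≠ x k ↔ (k = i ∨ k = j)) then (1:ℝ) else 0)), Finset.sum_boole]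
    norm_cast
    rw [Finset.card_le_one]
    rintro ⟨a, b⟩ ha ⟨c, e⟩ hc
    simp only [Finset.mem_filter, Finset.mem_univ, true_and] at ha hc
    obtain ⟨h, ha⟩ := ha
    obtain ⟨h', hc⟩ := hc
    have e1 := (hc a).1 ((ha a).2 (Or.inl rfl))
    have e2 := (hc b).1 ((ha b).2 (Or.inr rfl))
    have e3 := (ha c).1 ((hc c).2 (Or.inl rfl))
    have e4 := (ha e).1 ((hc e).2 (Or.inr rfl))
    rw [Prod.mk.injEq]
    constructor <;> omega
  nlinarith [mul_le_mul_of_nonneg_left h1 (show (0:ℝ) ≤ 2 * ((N:ℝ) - 1) by linarith)]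

lemma aux_cb {N L : ℕ} (hN : 2 ≤ N) (E : (Fin N → ZMod L) → ℝ) (β : ℝ)
    (x : Fin N → ZMod L) (i : Fin N) (d : Bool) :
    0 ≤ cb E β x i d ∧ cb E β x i d ≤ 1 / (2 * (N:ℝ)) := by
  have hN' : (2:ℝ) ≤ N := by exact_mod_cast hN
  unfold cb
  have := Real.exp_pos (β * (E (hop x i d) - E x))
  constructor
  · positivity
  · apply one_div_le_one_div_of_le (by positivity)
    nlinarith

lemma aux_term {N L : ℕ} (hN : 2 ≤ N) (hL : 3 ≤ L)
    (E : (Fin N → ZMod L) → ℝ)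
    (β p : ℝ) (hp : 0 ≤ p) (m : ℕ)
    (x y : Fin N → ZMod L) (i : Fin N) (d : Bool) :
    |∑ n ∈ Finset.Icc m (N - 1),
      (Nat.choose (n - 1) (m - 1) : ℝ) * (1 + (n : ℝ) * p) *
      (if nS x i d = n then
      p * cb E β x i d / (2 * (1 + (n : ℝ) * p)) *
        ∑ j ∈ Sset x i d, ∑ d' : Bool,
          ((if y = hop (hop x i d) j d' then (1 : ℝ) else 0)
            - (if y = hop x i d then 1 else 0))
      else 0)| ≤ (Nat.choose (N - 2) (m - 1) : ℝ) * (p * (1 / (2 * (N:ℝ))) / 2) * auxG x y i := by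
  have hG := aux_inner hN hL x y i d
  generalize (∑ j ∈ Sset x i d, ∑ d' : Bool,
          ((if y = hop (hop x i d) j d' then (1 : ℝ) else 0)
            - (if y = hop x i d then 1 else 0))) = W at hG ⊢
  obtain ⟨hc0, hc1⟩ := aux_cb hN E β x i d
  have hG0 : 0 ≤ auxG x y i := (abs_nonneg _).trans hG
  simp only [mul_ite, mul_zero, Finset.sum_ite_eq]
  split_ifs with h
  · have hle := aux_nS_le x i d
    generalize nS x i d = n at *
    have hch : (Nat.choose (n - 1) (m - 1) : ℝ) ≤ (Nat.choose (N - 2) (m - 1) : ℝ) := by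
      exact_mod_cast Nat.choose_le_choose _ (by omega)
    have hpos : 0 < 1 + (n:ℝ) * p := by positivity
    have : (Nat.choose (n - 1) (m - 1) : ℝ) * (1 + (n : ℝ) * p) *
      (p * cb E β x i d / (2 * (1 + (n : ℝ) * p)) * W) =
      (Nat.choose (n - 1) (m - 1) : ℝ) * (p * cb E β x i d / 2) * W := by
      field_simp
    rw [this, abs_mul, abs_of_nonneg (by positivity)]
    gcongr
  · rw [abs_zero]; positivity

/-- Entrywise bound for the `m`-th beta term:
`|⟨y|U_m|x⟩| ≤ (m−1)! · C(N−2, m−1) · p^m`. -/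
theorem rank_supplanting_Um_bound (N L : ℕ) (hN : 2 ≤ N) (hL : 3 ≤ L)
    (E : (Fin N → ZMod L) → ℝ)
    (hE : ∀ (σ : Equiv.Perm (Fin N)) (x : Fin N → ZMod L), E (x ∘ σ) = E x)
    (β p : ℝ) (hp : 0 ≤ p) (m : ℕ) (hm1 : 1 ≤ m) (hm2 : m ≤ N - 1)
    (x y : Fin N → ZMod L) :
    |Uterm E β p m y x|
      ≤ (Nat.factorial (m - 1) : ℝ) * (Nat.choose (N - 2) (m - 1) : ℝ) * p ^ m := by
  have hN' : (2:ℝ) ≤ N := by exact_mod_cast hN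
  have hS : |∑ n ∈ Finset.Icc m (N - 1),
      (Nat.choose (n - 1) (m - 1) : ℝ) * (1 + (n : ℝ) * p) * Tterm E β p n y x|
      ≤ (Nat.choose (N - 2) (m - 1) : ℝ) * p := by
    unfold Tterm
    simp_rw [Finset.mul_sum (s := (Finset.univ : Finset (Fin N)))]
    rw [Finset.sum_comm]
    refine (Finset.abs_sum_le_sum_abs _ _).trans ?_
    calc _ ≤ ∑ i : Fin N, 2 * ((Nat.choose (N - 2) (m - 1) : ℝ) *
            (p * (1 / (2 * (N:ℝ))) / 2) * auxG x y i) := by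
          refine Finset.sum_le_sum fun i _ => ?_
          have h1 := aux_term hN hL E β p hp m x y i true
          have h2 := aux_term hN hL E β p hp m x y i false
          simp_rw [Fintype.sum_bool (fun d => ite (nS x i d = _) _ _), mul_add]
          rw [Finset.sum_add_distrib]
          refine (abs_add_le _ _).trans ?_
          simp only [← mul_add] at *
          linarith
      _ ≤ _ := by
          rw [← Finset.mul_sum, ← Finset.mul_sum]
          have h3 := aux_G_sum hN x y
          calc _ ≤ 2 * ((Nat.choose (N - 2) (m - 1) : ℝ) *
            (p * (1 / (2 * (N:ℝ))) / 2) * (2 * (N:ℝ))) := by gcongr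
            _ = _ := by field_simp
  have hP : 1 ≤ ∏ k ∈ Finset.Icc 1 m, (1 + (k : ℝ) * p) := by
    refine Finset.prod_induction _ (fun a : ℝ => 1 ≤ a) (fun a b ha hb => ?_) le_rfl ?_
    · nlinarith
    · intro k _
      have : 0 ≤ (k:ℝ) * p := by positivity
      linarith
  unfold Uterm
  rw [abs_mul, abs_div, abs_mul, abs_mul, abs_pow, abs_neg, abs_one, one_pow, one_mul,
    abs_of_nonneg (by positivity : (0:ℝ) ≤ (Nat.factorial (m - 1) : ℝ)),
    abs_of_nonneg (by positivity : (0:ℝ) ≤ p ^ (m - 1)),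
    abs_of_nonneg (zero_le_one.trans hP)]
  have h5 : (Nat.factorial (m - 1) : ℝ) * p ^ (m - 1) / ∏ k ∈ Finset.Icc 1 m, (1 + (k : ℝ) * p)
      ≤ (Nat.factorial (m - 1) : ℝ) * p ^ (m - 1) := div_le_self (by positivity) hP
  calc _ ≤ ((Nat.factorial (m - 1) : ℝ) * p ^ (m - 1)) * ((Nat.choose (N - 2) (m - 1) : ℝ) * p) := by
        gcongr
    _ = _ := by
        obtain ⟨k, rfl⟩ : ∃ k, m = k + 1 := ⟨m - 1, by omega⟩
        simp only [Nat.add_sub_cancel]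
        ring
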